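/- Let p be a prime, K = ℂ_p, π ∈ K with π^{p-1} = −p, and A an n×n nonnegative integer matrix with 0 < det A < p whose reduction is Berglund–Hübsch over the residue field of K. Then Fr'_A = (Θ'_A ⊗ Id_{⋀(K^n)}) ∘ p^{Q_A} is a well-defined linear map B^†_A(K) → B^†_{pA}(K) and is a chain map: Fr'_A ∘ (d_A + d^∨_A) = (d_{pA} + d^∨_{pA}) ∘ Fr'_A. -/

import Mathlib

open scoped BigOperators TensorProduct
open Matrix Classical

noncomputable section

/-- The invertible-type polynomial `W_A = ∑ i, ∏ j, x_j ^ A i j`. -/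
def Wpoly (F : Type) [Field F] {ι : Type} [Fintype ι] (A : Matrix ι ι ℕ) :
    MvPolynomial ι F :=
  ∑ i, ∏ j, MvPolynomial.X j ^ A i j

/-- `A` is a Berglund–Hübsch matrix over the field `F`. -/
def IsBH (F : Type) [Field F] {ι : Type} [Fintype ι] [LinearOrder ι]
    (A : Matrix ι ι ℕ) : Prop :=
  (A.map ((↑) : ℕ → ℚ)).det ≠ 0 ∧
  (ringChar F = 0 ∨ ((A.map ((↑) : ℕ → ℤ)).det < (ringChar F : ℤ))) ∧
  (∃ q : ι → ℚ, (∀ j, 0 < q j) ∧ ∀ i, (∑ j, (A i j : ℚ) * q j) = 1) ∧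
  RingTheory.Sequence.IsRegular (MvPolynomial ι F)
    ((Finset.univ.sort (· ≤ ·)).map fun i => MvPolynomial.pderiv i (Wpoly F A))

/-- The model for the exterior algebra `⋀(Fⁿ)`: the free `F`-module on the standard
basis monomials `e_S = e_{s_1} ∧ … ∧ e_{s_k}`, `s_1 < … < s_k`, indexed by finite sets. -/
abbrev ExtV (F : Type) (ι : Type) := Finset ι → F

/-- Exterior multiplication by `e_i` on `⋀(Fⁿ)`. -/
def mulE (F : Type) [Field F] {ι : Type} [LinearOrder ι] (i : ι) :
    ExtV F ι →ₗ[F] ExtV F ι where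
  toFun f S := if i ∈ S then (-1 : F) ^ (S.filter (· < i)).card * f (S.erase i) else 0
  map_add' f g := by
    funext S
    by_cases h : i ∈ S <;> simp [h, mul_add]
  map_smul' a f := by
    funext S
    by_cases h : i ∈ S <;> simp [h, mul_left_comm]

/-- Contraction `e_i^∨` on `⋀(Fⁿ)`. -/
def contrE (F : Type) [Field F] {ι : Type} [LinearOrder ι] (i : ι) :
    ExtV F ι →ₗ[F] ExtV F ι where
  toFun f S := if i ∈ S then 0 else (-1 : F) ^ (S.filter (· < i)).card * f (insert i S)
  map_add' f g := by
    funext S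
    by_cases h : i ∈ S <;> simp [h, mul_add]
  map_smul' a f := by
    funext S
    by_cases h : i ∈ S <;> simp [h, mul_left_comm]

/-- `E_{A,i} = π ∑_j A_{ij} e_j`. -/
def EA (F : Type) [Field F] {ι : Type} [Fintype ι] [LinearOrder ι]
    (π : F) (A : Matrix ι ι ℕ) (i : ι) : ExtV F ι →ₗ[F] ExtV F ι :=
  π • ∑ j, (A i j : F) • mulE F j

/-- `E^∨_{A,i} = π⁻¹ ∑_j (A⁻¹)_{ji} e_j^∨`, the inverse matrix being computed over `F`. -/
def EAdual (F : Type) [Field F] {ι : Type} [Fintype ι] [LinearOrder ι]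
    (π : F) (A : Matrix ι ι ℕ) (i : ι) : ExtV F ι →ₗ[F] ExtV F ι :=
  π⁻¹ • ∑ j, ((A.map ((↑) : ℕ → F))⁻¹ j i) • contrE F j

/-- The element `E_{Aᵀ,1} E_{Aᵀ,2} ⋯ E_{Aᵀ,n} (1) ∈ ⋀(Fⁿ)`. -/
def starTop (F : Type) [Field F] {ι : Type} [Fintype ι] [LinearOrder ι]
    (π : F) (A : Matrix ι ι ℕ) : ExtV F ι :=
  (Finset.univ.sort (· ≤ ·)).foldr (fun i v => EA F π Aᵀ i v)
    (Pi.single (∅ : Finset ι) (1 : F))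

/-- Borisov's duality operator `*^A`, defined on the standard basis by
`*^A(e_{i_1} ∧ … ∧ e_{i_k}) = E^∨_{Aᵀ,i_1} ⋯ E^∨_{Aᵀ,i_k}(E_{Aᵀ,1} ⋯ E_{Aᵀ,n}(1))`. -/
def starA (F : Type) [Field F] {ι : Type} [Fintype ι] [LinearOrder ι]
    (π : F) (A : Matrix ι ι ℕ) : ExtV F ι →ₗ[F] ExtV F ι :=
  (Pi.basisFun F (Finset ι)).constr F fun S =>
    (S.sort (· ≤ ·)).foldr (fun i v => EAdual F π Aᵀ i v) (starTop F π A)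

/-- Index of a monomial `x^γ y^λ`. -/
abbrev MonIdx (ι : Type) := (ι → ℕ) × (ι → ℕ)

/-- The matrix `A` viewed over `ℚ`. -/
def Aq {ι : Type} [Fintype ι] [LinearOrder ι] (A : Matrix ι ι ℕ) : Matrix ι ι ℚ :=
  A.map ((↑) : ℕ → ℚ)

/-- The row vector `λ A⁻ᵀ`, computed over `ℚ`. -/
def lamRow {ι : Type} [Fintype ι] [LinearOrder ι] (A : Matrix ι ι ℕ) (lam : ι → ℕ) :
    ι → ℚ :=
  Matrix.vecMul (fun i => (lam i : ℚ)) ((Aq A)ᵀ)⁻¹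

/-- The row vector `γ A⁻¹`, computed over `ℚ`. -/
def gamRow {ι : Type} [Fintype ι] [LinearOrder ι] (A : Matrix ι ι ℕ) (gam : ι → ℕ) :
    ι → ℚ :=
  Matrix.vecMul (fun i => (gam i : ℚ)) (Aq A)⁻¹

/-- The allowed monomials `x^γ y^λ` of `R_A`: `(λA⁻ᵀ)_i ≥ 0` for all `i`, and
`γ A⁻¹ λᵀ = 0`. -/
def OKA {ι : Type} [Fintype ι] [LinearOrder ι] (A : Matrix ι ι ℕ) (m : MonIdx ι) : Prop :=
  (∀ i, 0 ≤ lamRow A m.2 i) ∧ (gamRow A m.1 ⬝ᵥ fun i => ((m.2 i : ℚ))) = 0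


/-- The allowed monomial indices of `R_A`. -/
abbrev AMon {n : ℕ} (A : Matrix (Fin n) (Fin n) ℕ) : Type := {m : MonIdx (Fin n) // OKA A m}

/-- Index set for coefficients of elements of `R_A ⊗ ⋀(Kⁿ)`. -/
abbrev BIdx {n : ℕ} (A : Matrix (Fin n) (Fin n) ℕ) : Type := AMon A × Finset (Fin n)

/-- The full coefficient space of (possibly infinite) series supported on the allowed
monomials of `R_A`. -/
abbrev RFull (K : Type) {n : ℕ} (A : Matrix (Fin n) (Fin n) ℕ) : Type := AMon A → K

/-- The full coefficient space of (possibly infinite) series in `R_A ⊗ ⋀(Kⁿ)`. -/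
abbrev BFull (K : Type) {n : ℕ} (A : Matrix (Fin n) (Fin n) ℕ) : Type := BIdx A → K

/-- Diagonal operator with weight `w`. -/
def diagOp {K : Type} [Field K] {α : Type} (w : α → K) : (α → K) →ₗ[K] (α → K) where
  toFun c a := w a * c a
  map_add' c c' := by funext a; simp [mul_add]
  map_smul' r c := by funext a; simp [mul_left_comm]

/-- The "transpose" of a partially defined index map: `(pullOp σ c) b = c (σ b)`,
with the convention that missing values contribute `0`. -/
def pullOp {K : Type} [Field K] {α β : Type} (σ : β → Option α) :
    (α → K) →ₗ[K] (β → K) where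
  toFun c b := ((σ b).map c).getD 0
  map_add' c c' := by funext b; cases h : σ b <;> simp [h]
  map_smul' r c := by funext b; cases h : σ b <;> simp [h]

/-- The tensor product `T ⊗ L` of a coefficientwise operator `T` on series and an
operator `L` on the (finite-dimensional) exterior algebra. -/
def tmap {K : Type} [Field K] {n : ℕ} {α β : Type}
    (T : (α → K) →ₗ[K] (β → K)) (L : ExtV K (Fin n) →ₗ[K] ExtV K (Fin n)) :
    (α × Finset (Fin n) → K) →ₗ[K] (β × Finset (Fin n) → K) where
  toFun c q := ∑ S : Finset (Fin n), L (Pi.single S 1) q.2 * T (fun m => c (m, S)) q.1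
  map_add' c c' := by
    funext q
    have h : ∀ S : Finset (Fin n), T (fun m => c (m, S) + c' (m, S))
        = T (fun m => c (m, S)) + T (fun m => c' (m, S)) := fun S =>
      map_add T (fun m => c (m, S)) (fun m => c' (m, S))
    simp only [Pi.add_apply]
    simp only [h, Pi.add_apply, mul_add, Finset.sum_add_distrib]
  map_smul' r c := by
    funext q
    have h : ∀ S : Finset (Fin n), T (fun m => r * c (m, S))
        = r • T (fun m => c (m, S)) := fun S =>
      _root_.map_smul T r (fun m => c (m, S))
    simp only [Pi.smul_apply, smul_eq_mul, RingHom.id_apply]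
    simp only [h, Pi.smul_apply, smul_eq_mul, Finset.mul_sum, mul_left_comm]

/-- `φ_{A,i} = π ∑_j A_{ji} x^{e_j A}·`, acting on coefficients of series. -/
def phiF (K : Type) [Field K] {n : ℕ} (π : K) (A : Matrix (Fin n) (Fin n) ℕ) (i : Fin n) :
    RFull K A →ₗ[K] RFull K A :=
  π • ∑ j, (A j i : K) • pullOp (fun m' : AMon A =>
    if h : (∀ k, A j k ≤ m'.1.1 k) ∧ OKA A ((fun k => m'.1.1 k - A j k), m'.1.2)
    then some ⟨((fun k => m'.1.1 k - A j k), m'.1.2), h.2⟩ else none)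

/-- `ψ^∨_{A,i} = y^{e_i Aᵀ}·`, acting on coefficients of series. -/
def psidualF (K : Type) [Field K] {n : ℕ} (A : Matrix (Fin n) (Fin n) ℕ) (i : Fin n) :
    RFull K A →ₗ[K] RFull K A :=
  pullOp (fun m' : AMon A =>
    if h : (∀ j, A j i ≤ m'.1.2 j) ∧ OKA A (m'.1.1, fun j => m'.1.2 j - A j i)
    then some ⟨(m'.1.1, fun j => m'.1.2 j - A j i), h.2⟩ else none)

/-- `θ_{A,i} + φ_{A,i}`. -/
def dxF (K : Type) [Field K] {n : ℕ} (π : K) (A : Matrix (Fin n) (Fin n) ℕ) (i : Fin n) :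
    RFull K A →ₗ[K] RFull K A :=
  diagOp (fun m => (m.1.1 i : K)) + phiF K π A i

/-- `T^∨_{A,i} + ψ^∨_{A,i}`. -/
def dyF (K : Type) [Field K] {n : ℕ} (π : K) (A : Matrix (Fin n) (Fin n) ℕ) (i : Fin n) :
    RFull K A →ₗ[K] RFull K A :=
  diagOp (fun m => π⁻¹ * ((lamRow A m.1.2 i : ℚ) : K)) + psidualF K A i

/-- The differential `d_A + d^∨_A` on series. -/
def dFull (K : Type) [Field K] {n : ℕ} (π : K) (A : Matrix (Fin n) (Fin n) ℕ) :
    BFull K A →ₗ[K] BFull K A :=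
  (∑ i, tmap (dxF K π A i) (mulE K i)) + ∑ i, tmap (dyF K π A i) (contrE K i)

/-- The total degree `|γ| + |λ|` of a monomial. -/
def degMon {n : ℕ} (m : MonIdx (Fin n)) : ℕ := (∑ i, m.1 i) + ∑ i, m.2 i

/-- Overconvergence (à la Dwork–Monsky) of a series: there is `M > 0` with
`ord_p(coefficient) ≥ M(|γ|+|λ|)`, i.e. `‖coefficient‖ ≤ p^{-M(|γ|+|λ|)}`, for all but
finitely many monomials. -/
def OvercR {K : Type} [NontriviallyNormedField K] {n : ℕ} {A : Matrix (Fin n) (Fin n) ℕ}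
    (p : ℕ) (c : RFull K A) : Prop :=
  ∃ M : ℝ, 0 < M ∧
    {m : AMon A | ¬ ‖c m‖ ≤ (p : ℝ) ^ (-(M * (degMon m.1 : ℝ)))}.Finite

/-- Overconvergence of an element of `B^†_A(K)`. -/
def OvercB {K : Type} [NontriviallyNormedField K] {n : ℕ} {A : Matrix (Fin n) (Fin n) ℕ}
    (p : ℕ) (c : BFull K A) : Prop :=
  ∃ M : ℝ, 0 < M ∧
    {q : BIdx A | ¬ ‖c q‖ ≤ (p : ℝ) ^ (-(M * (degMon q.1.1 : ℝ)))}.Finite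

/-- Polynomial (finitely supported) elements of `B_A(K)`. -/
def FinSuppB {K : Type} [Field K] {n : ℕ} {A : Matrix (Fin n) (Fin n) ℕ}
    (c : BFull K A) : Prop :=
  (Function.support c).Finite

/-- The condition `(γA⁻¹)_i ≥ 0` for all `i` cutting out `S_A ⊆ R_A`. -/
def gamOK {n : ℕ} (A : Matrix (Fin n) (Fin n) ℕ) (q : BIdx A) : Prop :=
  ∀ i, 0 ≤ gamRow A q.1.1.1 i

/-- Membership in the subcomplex `C_A(K) = S_A(K) ⊗ ⋀(Kⁿ)` (polynomial version). -/
def CFin {K : Type} [Field K] {n : ℕ} {A : Matrix (Fin n) (Fin n) ℕ}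
    (c : BFull K A) : Prop :=
  FinSuppB c ∧ ∀ q, c q ≠ 0 → gamOK A q

/-- Membership in the subcomplex `C^†_A(K) = S^†_A(K) ⊗ ⋀(Kⁿ)` (overconvergent
version). -/
def COver {K : Type} [NontriviallyNormedField K] {n : ℕ} {A : Matrix (Fin n) (Fin n) ℕ}
    (p : ℕ) (c : BFull K A) : Prop :=
  OvercB p c ∧ ∀ q, c q ≠ 0 → gamOK A q

/-- The eigenvalue of `Q^∨_A = ∑ i, Q^∨_{A,i}` on the basis monomial indexed by `q`:
the number of `i ∉ S` with `(λA⁻ᵀ)_i ≠ 0`. -/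
def qexpDual {n : ℕ} (A : Matrix (Fin n) (Fin n) ℕ) (q : BIdx A) : ℕ :=
  (Finset.univ.filter fun i => i ∉ q.2 ∧ lamRow A q.1.1.2 i ≠ 0).card

/-- The eigenvalue of `Q_A = ∑ i, Q_{A,i}` on the basis monomial indexed by `q`. -/
def qexpQ {n : ℕ} (A : Matrix (Fin n) (Fin n) ℕ) (q : BIdx A) : ℕ :=
  q.2.card + qexpDual A q

/-- The diagonal operator `p^{Q_A}`. -/
def pQdiag (K : Type) [Field K] {n : ℕ} (p : ℕ) (A : Matrix (Fin n) (Fin n) ℕ) :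
    BFull K A →ₗ[K] BFull K A :=
  diagOp fun q => (p : K) ^ (qexpQ A q)

/-- The diagonal operator `p^{Q^∨_A}`. -/
def pQdualdiag (K : Type) [Field K] {n : ℕ} (p : ℕ) (A : Matrix (Fin n) (Fin n) ℕ) :
    BFull K A →ₗ[K] BFull K A :=
  diagOp fun q => (p : K) ^ (qexpDual A q)

/-- The diagonal operator `p^{Q_A + Q^∨_A}`. -/
def pQQdualdiag (K : Type) [Field K] {n : ℕ} (p : ℕ) (A : Matrix (Fin n) (Fin n) ℕ) :
    BFull K A →ₗ[K] BFull K A :=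
  diagOp fun q => (p : K) ^ (qexpQ A q + qexpDual A q)

/-- The diagonal operator `p^{2·Q^∨_A}`. -/
def pQdual2diag (K : Type) [Field K] {n : ℕ} (p : ℕ) (A : Matrix (Fin n) (Fin n) ℕ) :
    BFull K A →ₗ[K] BFull K A :=
  diagOp fun q => (p : K) ^ (2 * qexpDual A q)

/-- The diagonal operator `p^{2·ext − n}` (where `ext` is the exterior degree). -/
def pExtDiag (K : Type) [Field K] {n : ℕ} (p : ℕ) (A : Matrix (Fin n) (Fin n) ℕ) :
    BFull K A →ₗ[K] BFull K A :=
  diagOp fun q => (p : K) ^ (2 * (q.2.card : ℤ) - (n : ℤ))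

/-- `Θ'_A : x^γ y^λ ↦ x^{pγ} y^{pλ}`, acting on coefficients of series. -/
def ThetaPrimeF (K : Type) [Field K] {n : ℕ} (p : ℕ) (A : Matrix (Fin n) (Fin n) ℕ) :
    RFull K A →ₗ[K] RFull K (p • A) :=
  pullOp fun m' : AMon (p • A) =>
    if h : OKA A ((fun i => m'.1.1 i / p), (fun i => m'.1.2 i / p)) ∧
        (∀ i, p ∣ m'.1.1 i ∧ p ∣ m'.1.2 i)
    then some ⟨((fun i => m'.1.1 i / p), (fun i => m'.1.2 i / p)), h.1⟩ else none

/-- `Fr'_A = (Θ'_A ⊗ Id) ∘ p^{Q_A} : B^†_A(K) → B^†_{pA}(K)`. -/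
def FrPrime (K : Type) [Field K] {n : ℕ} (p : ℕ)
    (A : Matrix (Fin n) (Fin n) ℕ) : BFull K A →ₗ[K] BFull K (p • A) :=
  (tmap (ThetaPrimeF K p A) LinearMap.id).comp (pQdiag K p A)

/-- The coefficients of the Dwork exponential `exp(π(t^p − t)) = ∑ d_m t^m`:
`d_m = ∑_{a + pb = m} (−1)^a π^{a+b}/(a! b!)`. -/
def dworkCoef (K : Type) [Field K] (p : ℕ) (π : K) (m : ℕ) : K :=
  ∑ ab ∈ Finset.range (m + 1) ×ˢ Finset.range (m + 1),
    if ab.1 + p * ab.2 = m then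
      ((-1 : K) ^ ab.1 * π ^ (ab.1 + ab.2)) / ((ab.1.factorial : K) * (ab.2.factorial : K))
    else 0

/-- The coefficient of `x^δ` in `Z_A(x) = exp(π(W_{pA}(x) − W_A(x)))
= ∏_i exp(π((x^{e_iA})^p − x^{e_iA}))`. -/
def Zcoef (K : Type) [Field K] {n : ℕ} (p : ℕ) (π : K) (A : Matrix (Fin n) (Fin n) ℕ)
    (δ : Fin n → ℕ) : K :=
  ∑ k ∈ Fintype.piFinset (fun _ : Fin n => Finset.range ((∑ j, δ j) + 1)),
    if ∀ j, (∑ i, k i * A i j) = δ j then ∏ i, dworkCoef K p π (k i) else 0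

/-- `Θ''_A`: multiplication by `Z_A(x) Z_{Aᵀ}(y)`, as a map `R^†_{pA}(K) → R^†_A(K)`
(computed on coefficients; monomials violating the support conditions are set to `0`). -/
def ZmulF (K : Type) [Field K] {n : ℕ} (p : ℕ) (π : K) (A : Matrix (Fin n) (Fin n) ℕ) :
    RFull K (p • A) →ₗ[K] RFull K A where
  toFun c m' :=
    ∑ δ ∈ Fintype.piFinset (fun _ : Fin n => Finset.range ((∑ j, m'.1.1 j) + 1)),
      ∑ ε ∈ Fintype.piFinset (fun _ : Fin n => Finset.range ((∑ j, m'.1.2 j) + 1)),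
        Zcoef K p π A δ * Zcoef K p π Aᵀ ε *
          (if h : (∀ k, δ k ≤ m'.1.1 k) ∧ (∀ k, ε k ≤ m'.1.2 k) ∧
              OKA (p • A) ((fun k => m'.1.1 k - δ k), (fun k => m'.1.2 k - ε k))
          then c ⟨((fun k => m'.1.1 k - δ k), (fun k => m'.1.2 k - ε k)), h.2.2⟩ else 0)
  map_add' c c' := by
    funext m'
    have key : ∀ (P : Prop) (hP : Decidable P) (f g : P → K),
        (dite P (fun h => f h + g h) (fun _ => (0 : K)))
          = dite P f (fun _ => 0) + dite P g (fun _ => 0) := by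
      intro P hP f g; split <;> simp
    simp only [Pi.add_apply, key, mul_add, Finset.sum_add_distrib]
  map_smul' r c := by
    funext m'
    have key : ∀ (P : Prop) (hP : Decidable P) (f : P → K),
        (dite P (fun h => r * f h) (fun _ => (0 : K))) = r * dite P f (fun _ => 0) := by
      intro P hP f; split <;> simp
    simp only [Pi.smul_apply, smul_eq_mul, RingHom.id_apply, key, Finset.mul_sum,
      mul_left_comm]

/-- `Fr''_A = (Θ''_A ⊗ Id) ∘ p^{Q^∨_{pA}} : B^†_{pA}(K) → B^†_A(K)`. -/
def FrDoublePrime (K : Type) [Field K] {n : ℕ} (p : ℕ) (π : K)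
    (A : Matrix (Fin n) (Fin n) ℕ) : BFull K (p • A) →ₗ[K] BFull K A :=
  (tmap (ZmulF K p π A) LinearMap.id).comp (pQdualdiag K p (p • A))

/-- The Frobenius endomorphism `Fr_A = ((Θ''_A ∘ Θ'_A) ⊗ Id) ∘ p^{Q_A + Q^∨_A}`. -/
def FrFull (K : Type) [Field K] {n : ℕ} (p : ℕ) (π : K)
    (A : Matrix (Fin n) (Fin n) ℕ) : BFull K A →ₗ[K] BFull K A :=
  (tmap ((ZmulF K p π A).comp (ThetaPrimeF K p A)) LinearMap.id).comp (pQQdualdiag K p A)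

/-- The transposition map `D^A : x^γ y^λ ↦ x^λ y^γ` on coefficients of series. -/
def DAmapF (K : Type) [Field K] {n : ℕ} (A : Matrix (Fin n) (Fin n) ℕ) :
    RFull K A →ₗ[K] RFull K Aᵀ :=
  pullOp fun m' : AMon Aᵀ =>
    if h : OKA A (m'.1.2, m'.1.1) then some ⟨(m'.1.2, m'.1.1), h⟩ else none

/-- Berglund–Hübsch duality `Δ^A = D^A ⊗ *^A` on series. -/
def DeltaF (K : Type) [Field K] {n : ℕ} (π : K) (A : Matrix (Fin n) (Fin n) ℕ) :
    BFull K A →ₗ[K] BFull K Aᵀ :=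
  tmap (DAmapF K A) (starA K π A)

/-- `Q̂_{A,i} = P̂_{A,i} ⊗ E_{A,i} E^∨_{A,i}` (the projection `P̂_{A,i}` is onto
monomials with `(γA⁻¹)_i ≠ 0`). -/
def QhatFull (K : Type) [Field K] {n : ℕ} (π : K) (A : Matrix (Fin n) (Fin n) ℕ)
    (i : Fin n) : BFull K A →ₗ[K] BFull K A :=
  tmap (diagOp fun m : AMon A => if gamRow A m.1.1 i = 0 then (0 : K) else 1)
    ((EA K π A i).comp (EAdual K π A i))

/-- `p^{−2Q̂_A} = ∏_i (Id + (p⁻² − 1) Q̂_{A,i})` (the `Q̂_{A,i}` are commuting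
idempotents). -/
def pQhatInvDiag (K : Type) [Field K] {n : ℕ} (p : ℕ) (π : K)
    (A : Matrix (Fin n) (Fin n) ℕ) : BFull K A →ₗ[K] BFull K A :=
  ((List.finRange n).map fun i =>
    LinearMap.id + ((p : K) ^ (-2 : ℤ) - 1) • QhatFull K π A i).foldr
    (fun f g => f.comp g) LinearMap.id

/-- `#_A`: the number of indices `i` with `(γA⁻¹)_i ∉ ℤ`. -/
def hashA {n : ℕ} (A : Matrix (Fin n) (Fin n) ℕ) (q : BIdx A) : ℤ :=
  ((Finset.univ.filter fun i => ¬ ∃ z : ℤ, gamRow A q.1.1.1 i = (z : ℚ)).card : ℤ)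

/-- `#^∨_A`: the number of indices `i` with `(λA⁻ᵀ)_i ∉ ℤ`. -/
def hashAdual {n : ℕ} (A : Matrix (Fin n) (Fin n) ℕ) (q : BIdx A) : ℤ :=
  ((Finset.univ.filter fun i => ¬ ∃ z : ℤ, lamRow A q.1.1.2 i = (z : ℚ)).card : ℤ)

/-- The diagonal twist `(κπ)^{(p−1)(#_A − #^∨_A)/2}`. -/
def TwistDiag (K : Type) [Field K] {n : ℕ} (p : ℕ) (κ π : K)
    (A : Matrix (Fin n) (Fin n) ℕ) : BFull K A →ₗ[K] BFull K A :=
  diagOp fun q => (κ * π) ^ ((((p : ℤ) - 1) / 2) * (hashA A q - hashAdual A q))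

/-- The twisted Frobenius `TFr_A = Fr_A ∘ (κπ)^{(p−1)(#_A − #^∨_A)/2}`. -/
def TFrFull (K : Type) [Field K] {n : ℕ} (p : ℕ) (κ π : K)
    (A : Matrix (Fin n) (Fin n) ℕ) : BFull K A →ₗ[K] BFull K A :=
  (FrFull K p π A).comp (TwistDiag K p κ π A)
end

section FrobeniusPrime

variable {K : Type} [Field K] {n p : ℕ} {A : Matrix (Fin n) (Fin n) ℕ}

theorem tmap_id_apply {α β : Type} (T : (α → K) →ₗ[K] (β → K)) (c : α × Finset (Fin n) → K)
    (b : β) (S : Finset (Fin n)) :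
    tmap T LinearMap.id c (b, S) = T (fun a => c (a, S)) b := by
  simp [tmap, Pi.single_apply]

theorem tmap_mulE_apply {α β : Type} (T : (α → K) →ₗ[K] (β → K)) (i : Fin n)
    (c : α × Finset (Fin n) → K) (b : β) (S : Finset (Fin n)) :
    tmap T (mulE K i) c (b, S) = if i ∈ S then
      (-1 : K) ^ (S.filter (· < i)).card * T (fun a => c (a, S.erase i)) b else 0 := by
  simp only [tmap, mulE, LinearMap.coe_mk, AddHom.coe_mk, Pi.single_apply]
  split_ifs <;> simp

theorem tmap_contrE_apply {α β : Type} (T : (α → K) →ₗ[K] (β → K)) (i : Fin n)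
    (c : α × Finset (Fin n) → K) (b : β) (S : Finset (Fin n)) :
    tmap T (contrE K i) c (b, S) = if i ∈ S then 0 else
      (-1 : K) ^ (S.filter (· < i)).card * T (fun a => c (a, insert i S)) b := by
  simp only [tmap, contrE, LinearMap.coe_mk, AddHom.coe_mk, Pi.single_apply]
  split_ifs <;> simp

theorem dFull_apply (π : K) (c : BFull K A) (m : AMon A) (S : Finset (Fin n)) :
    dFull K π A c (m, S) =
      (∑ i, if i ∈ S then
        (-1 : K) ^ (S.filter (· < i)).card * dxF K π A i (fun a => c (a, S.erase i)) m else 0) +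
      ∑ i, if i ∈ S then 0 else
        (-1 : K) ^ (S.filter (· < i)).card * dyF K π A i (fun a => c (a, insert i S)) m := by
  simp [dFull, tmap_mulE_apply, tmap_contrE_apply]

theorem FrPrime_apply (c : BFull K A) (m : AMon (p • A)) (S : Finset (Fin n)) :
    FrPrime K p A c (m, S) =
      ThetaPrimeF K p A (fun a => (p : K) ^ qexpQ A (a, S) * c (a, S)) m := by
  rw [FrPrime, LinearMap.comp_apply, tmap_id_apply]
  rfl

theorem Aq_smul (p : ℕ) (A : Matrix (Fin n) (Fin n) ℕ) : Aq (p • A) = (p : ℚ) • Aq A := by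
  ext i j
  simp [Aq, -nsmul_eq_mul]

theorem inv_Aq_smul (hp : p ≠ 0) (hA : (Aq A).det ≠ 0) :
    (Aq (p • A))⁻¹ = (p : ℚ)⁻¹ • (Aq A)⁻¹ := by
  have hp' : (p : ℚ) ≠ 0 := by exact_mod_cast hp
  rw [Aq_smul]
  refine Matrix.inv_eq_left_inv ?_
  rw [Matrix.smul_mul, Matrix.mul_smul, smul_smul, inv_mul_cancel₀ hp', one_smul,
    Matrix.nonsing_inv_mul _ (isUnit_iff_ne_zero.2 hA)]

theorem lamRow_eq (A : Matrix (Fin n) (Fin n) ℕ) (lam : Fin n → ℕ) :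
    lamRow A lam = (Aq A)⁻¹ *ᵥ fun i => (lam i : ℚ) := by
  rw [lamRow, ← Matrix.transpose_nonsing_inv, Matrix.vecMul_transpose]

theorem natCast_smul_apply (p : ℕ) (v : Fin n → ℕ) :
    (fun i => ((p • v) i : ℚ)) = (p : ℚ) • fun i => (v i : ℚ) := by
  ext i
  simp

theorem lamRow_smul (hp : p ≠ 0) (hA : (Aq A).det ≠ 0) (lam : Fin n → ℕ) :
    lamRow (p • A) (p • lam) = lamRow A lam := by
  have hp' : (p : ℚ) ≠ 0 := by exact_mod_cast hp
  rw [lamRow_eq, lamRow_eq, inv_Aq_smul hp hA, natCast_smul_apply, Matrix.mulVec_smul,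
    Matrix.smul_mulVec, smul_smul, mul_inv_cancel₀ hp', one_smul]

theorem gamRow_smul (hp : p ≠ 0) (hA : (Aq A).det ≠ 0) (gam : Fin n → ℕ) :
    gamRow (p • A) (p • gam) = gamRow A gam := by
  have hp' : (p : ℚ) ≠ 0 := by exact_mod_cast hp
  rw [gamRow, gamRow, inv_Aq_smul hp hA, natCast_smul_apply, Matrix.smul_vecMul,
    Matrix.vecMul_smul, smul_smul, mul_inv_cancel₀ hp', one_smul]

theorem OKA_smul (hp : p ≠ 0) (hA : (Aq A).det ≠ 0) (m : MonIdx (Fin n)) :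
    OKA (p • A) (p • m) ↔ OKA A m := by
  have hp' : (p : ℚ) ≠ 0 := by exact_mod_cast hp
  simp only [OKA, Prod.smul_fst, Prod.smul_snd, lamRow_smul hp hA, gamRow_smul hp hA]
  rw [natCast_smul_apply, dotProduct_smul, smul_eq_mul, mul_eq_zero, or_iff_right hp']

theorem OKA.fst_eq_zero_of_lamRow_ne_zero {m : MonIdx (Fin n)} (hm : OKA A m) {i : Fin n}
    (hi : lamRow A m.2 i ≠ 0) : m.1 i = 0 := by
  have h := hm.2
  rw [gamRow, ← Matrix.dotProduct_mulVec, ← lamRow_eq, dotProduct,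
    Finset.sum_eq_zero_iff_of_nonneg fun k _ => mul_nonneg (Nat.cast_nonneg _) (hm.1 k)] at h
  simpa [hi] using h i (Finset.mem_univ i)

theorem lamRow_add_col (hA : (Aq A).det ≠ 0) (lam : Fin n → ℕ) (i : Fin n) :
    lamRow A (fun j => lam j + A j i) = lamRow A lam + Pi.single i 1 := by
  have h : (fun j => ((lam j + A j i : ℕ) : ℚ)) =
      (fun j => (lam j : ℚ)) + Aq A *ᵥ Pi.single i 1 := by
    ext j
    simp [Aq]
  rw [lamRow_eq, lamRow_eq, h, Matrix.mulVec_add, Matrix.mulVec_mulVec,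
    Matrix.nonsing_inv_mul _ (isUnit_iff_ne_zero.2 hA), Matrix.one_mulVec]

/-- Extension by zero of the coefficients of a series to all monomials. -/
noncomputable def coeffExt (f : RFull K A) (m : MonIdx (Fin n)) : K :=
  if h : OKA A m then f ⟨m, h⟩ else 0

theorem coeffExt_val (f : RFull K A) (m : AMon A) : coeffExt f m.1 = f m :=
  dif_pos m.2

theorem coeffExt_mul (w f : RFull K A) (a : K) (m : MonIdx (Fin n))
    (h : ∀ hm : OKA A m, w ⟨m, hm⟩ = a) :
    coeffExt (fun m => w m * f m) m = a * coeffExt f m := by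
  unfold coeffExt
  split_ifs with hm
  · exact congrArg (· * f ⟨m, hm⟩) (h hm)
  · simp

theorem ThetaPrimeF_apply (f : RFull K A) (m : AMon (p • A)) :
    ThetaPrimeF K p A f m = if ∀ i, p ∣ m.1.1 i ∧ p ∣ m.1.2 i then
      coeffExt f ((fun i => m.1.1 i / p), fun i => m.1.2 i / p) else 0 := by
  simp only [ThetaPrimeF, pullOp, coeffExt, LinearMap.coe_mk, AddHom.coe_mk]
  split_ifs <;> first | rfl | tauto

theorem coeffExt_ThetaPrimeF_smul (hp : p ≠ 0) (hA : (Aq A).det ≠ 0) (f : RFull K A)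
    (m : MonIdx (Fin n)) : coeffExt (ThetaPrimeF K p A f) (p • m) = coeffExt f m := by
  by_cases h : OKA (p • A) (p • m)
  · rw [coeffExt, dif_pos h, ThetaPrimeF_apply]
    simp [Nat.mul_div_cancel_left _ (Nat.pos_of_ne_zero hp)]
  · rw [coeffExt, dif_neg h, coeffExt, dif_neg (mt (OKA_smul hp hA m).2 h)]

theorem coeffExt_ThetaPrimeF_of_not_dvd (f : RFull K A) {m : MonIdx (Fin n)}
    (h : ¬ ∀ i, p ∣ m.1 i ∧ p ∣ m.2 i) : coeffExt (ThetaPrimeF K p A f) m = 0 := by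
  unfold coeffExt
  split_ifs
  · rw [ThetaPrimeF_apply, if_neg h]
  · rfl

theorem exists_eq_smul_of_dvd {m : MonIdx (Fin n)} (h : ∀ i, p ∣ m.1 i ∧ p ∣ m.2 i) :
    ∃ m₀ : MonIdx (Fin n), m = p • m₀ := by
  refine ⟨((fun i => m.1 i / p), fun i => m.2 i / p), Prod.ext ?_ ?_⟩ <;> funext i
  · simp [Nat.mul_div_cancel' (h i).1]
  · simp [Nat.mul_div_cancel' (h i).2]

theorem dxF_apply (π : K) (i : Fin n) (f : RFull K A) (m : AMon A) :
    dxF K π A i f m = m.1.1 i * f m + π * ∑ j, (A j i : K) *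
      if ∀ k, A j k ≤ m.1.1 k then coeffExt f ((fun k => m.1.1 k - A j k), m.1.2) else 0 := by
  simp only [dxF, phiF, diagOp, LinearMap.add_apply, LinearMap.smul_apply, LinearMap.sum_apply,
    Pi.add_apply, Pi.smul_apply, Finset.sum_apply, LinearMap.coe_mk, AddHom.coe_mk, smul_eq_mul]
  congr 2
  refine Finset.sum_congr rfl fun j _ => ?_
  congr 1
  simp only [pullOp, coeffExt, LinearMap.coe_mk, AddHom.coe_mk]
  split_ifs <;> first | rfl | tauto

theorem dyF_apply (π : K) (i : Fin n) (f : RFull K A) (m : AMon A) :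
    dyF K π A i f m = π⁻¹ * ((lamRow A m.1.2 i : ℚ) : K) * f m +
      if ∀ j, A j i ≤ m.1.2 j then coeffExt f (m.1.1, fun j => m.1.2 j - A j i) else 0 := by
  simp only [dyF, psidualF, diagOp, LinearMap.add_apply,
    Pi.add_apply, LinearMap.coe_mk, AddHom.coe_mk]
  congr 1
  simp only [pullOp, coeffExt, LinearMap.coe_mk, AddHom.coe_mk]
  split_ifs <;> first | rfl | tauto

/-- The exponent of `p` in `p^{Q_A}` as a sum of local contributions. -/
theorem qexpQ_eq_sum (m : AMon A) (S : Finset (Fin n)) :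
    qexpQ A (m, S) = ∑ i, if i ∈ S ∨ lamRow A m.1.2 i ≠ 0 then 1 else 0 := by
  have hS : S.card = ∑ i, if i ∈ S then 1 else 0 := by simp
  rw [qexpQ, qexpDual, hS, Finset.card_filter, ← Finset.sum_add_distrib]
  refine Finset.sum_congr rfl fun i _ => ?_
  by_cases h : i ∈ S <;> simp [h]

theorem qexpQ_erase {m : AMon A} {S : Finset (Fin n)} {i : Fin n} (hi : i ∈ S)
    (h : lamRow A m.1.2 i = 0) : qexpQ A (m, S) = qexpQ A (m, S.erase i) + 1 := by
  rw [qexpQ_eq_sum, qexpQ_eq_sum, ← Finset.add_sum_erase _ _ (Finset.mem_univ i),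
    ← Finset.add_sum_erase _ _ (Finset.mem_univ i)]
  have : ∀ k ∈ Finset.univ.erase i, (if k ∈ S ∨ lamRow A m.1.2 k ≠ 0 then 1 else 0) =
      if k ∈ S.erase i ∨ lamRow A m.1.2 k ≠ 0 then 1 else 0 := by
    intro k hk
    simp [Finset.ne_of_mem_erase hk]
  rw [Finset.sum_congr rfl this]
  simp [hi, h, add_comm]

/-- The `p^{Q_A}`-exponent does not change when `i` is added to the exterior part, if
`(λA⁻ᵀ)_i` is nonzero for the smaller exterior part. -/
theorem qexpQ_insert {m m' : AMon A} {S : Finset (Fin n)} {i : Fin n}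
    (h : lamRow A m.1.2 i ≠ 0) (hm : ∀ k ≠ i, lamRow A m'.1.2 k = lamRow A m.1.2 k) :
    qexpQ A (m', insert i S) = qexpQ A (m, S) := by
  rw [qexpQ_eq_sum, qexpQ_eq_sum]
  refine Finset.sum_congr rfl fun k _ => ?_
  by_cases hk : k = i
  · subst hk
    simp [h]
  · simp [hk, hm k hk]

theorem ThetaPrimeF_dxF (hp : p ≠ 0) (hA : (Aq A).det ≠ 0) {π : K} {i : Fin n}
    {S : Finset (Fin n)} (hi : i ∈ S) {f : RFull K A} {m : AMon (p • A)} :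
    ThetaPrimeF K p A (fun a => (p : K) ^ qexpQ A (a, S) * dxF K π A i f a) m =
      dxF K π (p • A) i
        (ThetaPrimeF K p A fun a => (p : K) ^ qexpQ A (a, S.erase i) * f a) m := by
  rw [dxF_apply, ← coeffExt_val (ThetaPrimeF K p A _), ← coeffExt_val (ThetaPrimeF K p A _)]
  obtain ⟨m, hm'⟩ := m
  dsimp only
  by_cases hdvd : ∀ k, p ∣ m.1 k ∧ p ∣ m.2 k
  · obtain ⟨m, rfl⟩ := exists_eq_smul_of_dvd hdvd
    have hm := (OKA_smul hp hA m).1 hm'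
    rw [coeffExt_ThetaPrimeF_smul hp hA, coeffExt_ThetaPrimeF_smul hp hA, coeffExt, dif_pos hm,
      coeffExt, dif_pos hm, dxF_apply]
    have hsum : ∀ j, (if ∀ k, (p • A) j k ≤ (p • m).1 k then
        coeffExt (ThetaPrimeF K p A fun a => (p : K) ^ qexpQ A (a, S.erase i) * f a)
          ((fun k => (p • m).1 k - (p • A) j k), (p • m).2) else 0) =
        (p : K) ^ qexpQ A (⟨m, hm⟩, S.erase i) *
          if ∀ k, A j k ≤ m.1 k then coeffExt f ((fun k => m.1 k - A j k), m.2) else 0 := by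
      intro j
      have h₁ : (∀ k, (p • A) j k ≤ (p • m).1 k) ↔ ∀ k, A j k ≤ m.1 k := by
        simp [-nsmul_eq_mul, Nat.mul_le_mul_left_iff (Nat.pos_of_ne_zero hp)]
      have h₂ : ((fun k => (p • m).1 k - (p • A) j k), (p • m).2) =
          p • (((fun k => m.1 k - A j k), m.2) : MonIdx (Fin n)) := by
        refine Prod.ext ?_ rfl
        funext k
        simp [-nsmul_eq_mul, Nat.mul_sub]
      rw [h₂, coeffExt_ThetaPrimeF_smul hp hA]
      simp only [h₁, mul_ite, mul_zero]
      rw [coeffExt_mul (fun a => (p : K) ^ qexpQ A (a, S.erase i)) f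
        ((p : K) ^ qexpQ A (⟨m, hm⟩, S.erase i))]
      intro h
      simp [qexpQ_eq_sum]
    simp only [hsum]
    by_cases hl : lamRow A m.2 i = 0
    · rw [qexpQ_erase hi hl]
      simp only [Prod.smul_fst, Pi.smul_apply, Matrix.smul_apply, smul_eq_mul, Nat.cast_mul,
        mul_add, Finset.mul_sum, pow_succ]
      congr 1
      · ring
      · exact Finset.sum_congr rfl fun j _ => by ring
    · have h0 := hm.fst_eq_zero_of_lamRow_ne_zero hl
      have hz : ∀ j, (A j i : K) * (if ∀ k, A j k ≤ m.1 k then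
          coeffExt f ((fun k => m.1 k - A j k), m.2) else 0) = 0 := by
        intro j
        split_ifs with hle
        · have : A j i = 0 := by simpa [h0] using hle i
          simp [this]
        · simp
      have hz' : ∀ j, (((p • A) j i : ℕ) : K) * ((p : K) ^ qexpQ A (⟨m, hm⟩, S.erase i) *
          if ∀ k, A j k ≤ m.1 k then
            coeffExt f ((fun k => m.1 k - A j k), m.2) else 0) = 0 := by
        intro j
        rw [mul_left_comm, Matrix.smul_apply, smul_eq_mul, Nat.cast_mul, mul_assoc, hz,
          mul_zero, mul_zero]
      simp only [hz, hz', h0]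
      simp [h0]
  · rw [coeffExt_ThetaPrimeF_of_not_dvd _ hdvd, coeffExt_ThetaPrimeF_of_not_dvd _ hdvd,
      Finset.sum_eq_zero, mul_zero, mul_zero, add_zero]
    intro j _
    split_ifs with hle
    · rw [coeffExt_ThetaPrimeF_of_not_dvd, mul_zero]
      refine mt (fun h k => ⟨?_, (h k).2⟩) hdvd
      exact (Nat.dvd_sub_iff_left (hle k) (Dvd.intro _ rfl)).1 (h k).1
    · rw [mul_zero]

theorem ThetaPrimeF_dyF (hp : p ≠ 0) (hA : (Aq A).det ≠ 0) {π : K} {i : Fin n}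
    {S : Finset (Fin n)} {f : RFull K A} {m : AMon (p • A)} :
    ThetaPrimeF K p A (fun a => (p : K) ^ qexpQ A (a, S) * dyF K π A i f a) m =
      dyF K π (p • A) i
        (ThetaPrimeF K p A fun a => (p : K) ^ qexpQ A (a, insert i S) * f a) m := by
  rw [dyF_apply, ← coeffExt_val (ThetaPrimeF K p A _), ← coeffExt_val (ThetaPrimeF K p A _)]
  obtain ⟨m, hm'⟩ := m
  dsimp only
  by_cases hdvd : ∀ k, p ∣ m.1 k ∧ p ∣ m.2 k
  · obtain ⟨m, rfl⟩ := exists_eq_smul_of_dvd hdvd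
    have hm := (OKA_smul hp hA m).1 hm'
    rw [coeffExt_ThetaPrimeF_smul hp hA, coeffExt_ThetaPrimeF_smul hp hA, coeffExt, dif_pos hm,
      coeffExt, dif_pos hm, dyF_apply, mul_add]
    congr 1
    · rw [Prod.smul_snd, lamRow_smul hp hA]
      by_cases hl : lamRow A m.2 i = 0
      · simp [hl]
      · rw [qexpQ_insert (m := ⟨m, hm⟩) (m' := ⟨m, hm⟩) hl fun _ _ => rfl]
        ring
    · have h₁ : (∀ j, (p • A) j i ≤ (p • m).2 j) ↔ ∀ j, A j i ≤ m.2 j := by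
        simp [-nsmul_eq_mul, Nat.mul_le_mul_left_iff (Nat.pos_of_ne_zero hp)]
      have h₂ : ((p • m).1, fun j => (p • m).2 j - (p • A) j i) =
          p • ((m.1, fun j => m.2 j - A j i) : MonIdx (Fin n)) := by
        refine Prod.ext rfl ?_
        funext k
        simp [-nsmul_eq_mul, Nat.mul_sub]
      rw [h₂, coeffExt_ThetaPrimeF_smul hp hA]
      simp only [h₁, mul_ite, mul_zero]
      split_ifs with hle
      · symm
        refine coeffExt_mul (fun a => (p : K) ^ qexpQ A (a, insert i S)) f _ _ fun h => ?_
        have hl : lamRow A m.2 = lamRow A (fun j => m.2 j - A j i) + Pi.single i 1 := by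
          rw [← lamRow_add_col hA]
          congr 1
          funext j
          exact (Nat.sub_add_cancel (hle j)).symm
        rw [qexpQ_insert (m := ⟨m, hm⟩)]
        · have := h.1 i
          rw [hl, Pi.add_apply, Pi.single_eq_same]
          exact (add_pos_of_nonneg_of_pos this one_pos).ne'
        · intro k hk
          simp [hl, hk]
      · rfl
  · rw [coeffExt_ThetaPrimeF_of_not_dvd _ hdvd, coeffExt_ThetaPrimeF_of_not_dvd _ hdvd,
      mul_zero, zero_add]
    split_ifs with hle
    · rw [coeffExt_ThetaPrimeF_of_not_dvd]
      refine mt (fun h k => ⟨(h k).1, ?_⟩) hdvd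
      exact (Nat.dvd_sub_iff_left (hle k) (Dvd.intro _ rfl)).1 (h k).2
    · rfl

end FrobeniusPrime

theorem degMon_smul {n : ℕ} (p : ℕ) (m : MonIdx (Fin n)) : degMon (p • m) = p * degMon m := by
  simp [degMon, mul_add, Finset.mul_sum]

theorem overcB_FrPrime {K : Type} [NontriviallyNormedField K] {n p : ℕ}
    {A : Matrix (Fin n) (Fin n) ℕ} (hp : p ≠ 0) (hpK : ‖(p : K)‖ ≤ 1) (hA : (Aq A).det ≠ 0)
    {c : BFull K A} (hc : OvercB p c) : OvercB p (FrPrime K p A c) := by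
  obtain ⟨M, hM, hfin⟩ := hc
  have hp' : (0 : ℝ) < p := by exact_mod_cast Nat.pos_of_ne_zero hp
  refine ⟨M / p, by positivity, (hfin.image fun q =>
    ((⟨p • q.1.1, (OKA_smul hp hA _).2 q.1.2⟩ : AMon (p • A)), q.2)).subset ?_⟩
  rintro ⟨⟨m, hm'⟩, S⟩ hq
  rw [Set.mem_ofPred_eq, FrPrime_apply, ← coeffExt_val (ThetaPrimeF K p A _)] at hq
  by_cases hdvd : ∀ k, p ∣ m.1 k ∧ p ∣ m.2 k
  · obtain ⟨m, rfl⟩ := exists_eq_smul_of_dvd hdvd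
    have hm := (OKA_smul hp hA m).1 hm'
    refine ⟨(⟨m, hm⟩, S), fun hle => hq ?_, rfl⟩
    rw [coeffExt_ThetaPrimeF_smul hp hA, coeffExt, dif_pos hm, norm_mul, norm_pow]
    have hexp : M / p * (degMon (p • m) : ℝ) = M * degMon m := by
      rw [degMon_smul, Nat.cast_mul]
      field_simp
    dsimp only at hle ⊢
    rw [hexp]
    exact (mul_le_of_le_one_left (norm_nonneg _) (pow_le_one₀ (norm_nonneg _) hpK)).trans hle
  · rw [coeffExt_ThetaPrimeF_of_not_dvd _ hdvd, norm_zero] at hq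
    exact absurd (Real.rpow_nonneg hp'.le _) hq

/-- Lemma 9.1: over a `ℂ_p`-like field, `Fr'_A = (Θ'_A ⊗ Id) ∘ p^{Q_A}` is a
well-defined linear map `B^†_A(K) → B^†_{pA}(K)` and a chain map:
`Fr'_A ∘ (d_A + d^∨_A) = (d_{pA} + d^∨_{pA}) ∘ Fr'_A`. -/
theorem FrPrime_chain_map
    (p : ℕ) [hp : Fact p.Prime] (K : Type) [NontriviallyNormedField K] [CompleteSpace K]
    [CharZero K] (halg : IsAlgClosed K)
    (hna : ∀ a b : K, ‖a + b‖ ≤ max ‖a‖ ‖b‖) (hpnorm : ‖(p : K)‖ = (p : ℝ)⁻¹)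
    (π : K) (hπ : π ^ (p - 1) = -(p : K))
    (n : ℕ) (A : Matrix (Fin n) (Fin n) ℕ)
    (hdet : 0 < (A.map ((↑) : ℕ → ℤ)).det ∧ (A.map ((↑) : ℕ → ℤ)).det < (p : ℤ))
    (hABH : IsBH (AlgebraicClosure (ZMod p)) A) :
    (∀ c : BFull K A, OvercB p c → OvercB p (FrPrime K p A c)) ∧
    (FrPrime K p A).comp (dFull K π A) = (dFull K π (p • A)).comp (FrPrime K p A) := by
  have hp0 : p ≠ 0 := hp.out.ne_zero
  have hA : (Aq A).det ≠ 0 := hABH.1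
  refine ⟨fun c hc => overcB_FrPrime hp0 (by
    rw [hpnorm]; exact inv_le_one_of_one_le₀ (by exact_mod_cast hp.out.one_lt.le)) hA hc, ?_⟩
  refine LinearMap.ext fun c => funext fun q => ?_
  obtain ⟨m, S⟩ := q
  simp only [LinearMap.comp_apply]
  rw [FrPrime_apply, dFull_apply]
  simp only [FrPrime_apply]
  have hd : (fun m : AMon A => (p : K) ^ qexpQ A (m, S) * dFull K π A c (m, S)) =
      (∑ i, if i ∈ S then (-1 : K) ^ (S.filter (· < i)).card •
          (fun m : AMon A => (p : K) ^ qexpQ A (m, S) *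
            dxF K π A i (fun m => c (m, S.erase i)) m) else 0) +
      ∑ i, if i ∈ S then 0 else (-1 : K) ^ (S.filter (· < i)).card •
          (fun m : AMon A => (p : K) ^ qexpQ A (m, S) *
            dyF K π A i (fun m => c (m, insert i S)) m) := by
    funext m
    rw [dFull_apply]
    simp only [Pi.add_apply, Finset.sum_apply, mul_add, Finset.mul_sum]
    congr 1 <;> refine Finset.sum_congr rfl fun i _ => ?_ <;> split_ifs <;>
      simp [mul_left_comm]
  rw [hd, map_add, map_sum, map_sum, Pi.add_apply, Finset.sum_apply, Finset.sum_apply]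
  congr 1 <;> refine Finset.sum_congr rfl fun i _ => ?_ <;> split_ifs with hi
  · rw [map_smul, Pi.smul_apply, smul_eq_mul, ThetaPrimeF_dxF hp0 hA hi]
  · simp
  · simp
  · rw [map_smul, Pi.smul_apply, smul_eq_mul, ThetaPrimeF_dyF hp0 hA]
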